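/- arXiv:1703.05160 — 2 statements merged into one kernel-verified Lean document; each statement's English description precedes it below -/
import Mathlib

section
/- Let M : ℝ → ℝ be a strictly monotonically increasing function taking values in (0, 1), let K, L be positive integers, let x ∈ ℝ^D be a feature vector, and let θ_y ∈ ℝ^D for y in a finite nonempty set Y. Define f(y) = exp(⟨θ_y, x⟩) and p_y = 1 − (1 − M(⟨θ_y, x⟩)^K)^L. Then a state y* ∈ Y maximizes f over Y if and only if y* maximizes p over Y; i.e., the set of modes of the (unnormalized) target distribution f and that of the sampling distribution p are identical. -/
open scoped RealInnerProductSpace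

/-- The retrieval probability of a `(K, L)`-parametrized LSH scheme is strictly increasing in the
similarity. -/
theorem strictMono_lsh_retrieval {M : ℝ → ℝ} (hM : StrictMono M)
    (hM01 : ∀ t, M t ∈ Set.Ioo (0 : ℝ) 1) {K L : ℕ} (hK : 0 < K) (hL : 0 < L) :
    StrictMono fun t => 1 - (1 - M t ^ K) ^ L := by
  intro s t hst
  have hpow : M s ^ K < M t ^ K := pow_lt_pow_left₀ (hM hst) (hM01 s).1.le hK.ne'
  have hle : M t ^ K ≤ 1 := pow_le_one₀ (hM01 t).1.le (hM01 t).2.le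
  exact sub_lt_sub_left
    (pow_lt_pow_left₀ (sub_lt_sub_left hpow 1) (sub_nonneg.2 hle) hL.ne') 1

/-- **The target distribution and the LSH sampling distribution have the same modes.**
With `f y = exp ⟪θ y, x⟫` and `p y = 1 − (1 − M(⟪θ y, x⟫)^K)^L` for strictly increasing
`M` with values in `(0,1)` and `K, L ≥ 1`, a state `ystar` maximizes `f` over the finite
nonempty state space `Y` if and only if it maximizes `p` over `Y`. -/
theorem lsh_same_modes {Y : Type*} [Fintype Y] [Nonempty Y] {D : ℕ}
    (M : ℝ → ℝ) (hM : StrictMono M) (hM01 : ∀ t, M t ∈ Set.Ioo (0 : ℝ) 1)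
    (K L : ℕ) (hK : 0 < K) (hL : 0 < L)
    (x : EuclideanSpace ℝ (Fin D)) (θ : Y → EuclideanSpace ℝ (Fin D)) (ystar : Y) :
    (∀ y, Real.exp ⟪θ y, x⟫ ≤ Real.exp ⟪θ ystar, x⟫) ↔
      (∀ y, 1 - (1 - M ⟪θ y, x⟫ ^ K) ^ L ≤ 1 - (1 - M ⟪θ ystar, x⟫ ^ K) ^ L) := by
  refine forall_congr' fun y => ?_
  rw [Real.exp_le_exp]
  exact (strictMono_lsh_retrieval hM hM01 hK hL).le_iff_le.symm
end

section
/- Let x, y ∈ ℝ^D be nonzero vectors, neither a scalar multiple of the other, and let θ = arccos(⟨x, y⟩/(‖x‖ ‖y‖)) ∈ [0, π] be the angle between them. If w ∈ ℝ^D is a random vector with the standard Gaussian distribution on ℝ^D (so that its direction is uniformly distributed on the unit sphere), then the probability that the signed random projection hash values of x and y agree satisfies P[sign(⟨w, x⟩) = sign(⟨w, y⟩)] = 1 − θ/π. -/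
open MeasureTheory ProbabilityTheory

open scoped ENNReal

/-- The coordinates of a standard Gaussian vector along an orthonormal family are independent
standard Gaussian variables. -/
theorem map_inner_stdGaussian {E ι : Type*} [NormedAddCommGroup E] [InnerProductSpace ℝ E]
    [FiniteDimensional ℝ E] [MeasurableSpace E] [BorelSpace E] [Fintype ι]
    {e : ι → E} (he : Orthonormal ℝ e) :
    (stdGaussian E).map (fun w i => inner ℝ (e i) w) =
      Measure.pi fun _ : ι => gaussianReal 0 1 := by
  have key : (stdGaussian E).map (fun w => WithLp.toLp 2 fun i => inner ℝ (e i) w) =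
      stdGaussian (EuclideanSpace ℝ ι) := by
    have hm : Measurable fun w : E => WithLp.toLp 2 fun i => inner ℝ (e i) w := by fun_prop
    have : IsProbabilityMeasure
        ((stdGaussian E).map (fun w => WithLp.toLp 2 fun i => inner ℝ (e i) w)) :=
      Measure.isProbabilityMeasure_map hm.aemeasurable
    apply Measure.ext_of_charFun
    ext t
    have hinner (w : E) : inner ℝ (WithLp.toLp 2 fun i => inner ℝ (e i) w) t =
        inner ℝ w (∑ i, t i • e i) := by
      simp [PiLp.inner_apply, inner_sum, inner_smul_right, real_inner_comm]
    have hnorm : ‖∑ i, t i • e i‖ ^ 2 = ‖t‖ ^ 2 := by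
      rw [← real_inner_self_eq_norm_sq, he.inner_sum, EuclideanSpace.real_norm_sq_eq]
      simp [sq]
    rw [charFun_apply, integral_map hm.aemeasurable (by fun_prop)]
    simp_rw [hinner]
    rw [← charFun_apply, charFun_stdGaussian, charFun_stdGaussian, ← Complex.ofReal_pow,
      ← Complex.ofReal_pow, hnorm]
  have hmap := congrArg (Measure.map (WithLp.ofLp (p := 2))) key
  rw [← map_pi_eq_stdGaussian, Measure.map_map (by fun_prop) (by fun_prop),
    Measure.map_map (by fun_prop) (by fun_prop)] at hmap
  exact hmap.trans Measure.map_id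

/-- The standard Gaussian measure of a planar cone is its angular measure divided by `2π`. -/
theorem gaussianReal_prod_cone {A : Set (ℝ × ℝ)} {S : Set ℝ} (hA : MeasurableSet A)
    (hS : MeasurableSet S)
    (h : ∀ r φ : ℝ, 0 < r → φ ∈ Set.Ioo (-Real.pi) Real.pi →
      ((r * Real.cos φ, r * Real.sin φ) ∈ A ↔ φ ∈ S)) :
    ((gaussianReal 0 1).prod (gaussianReal 0 1)) A =
      volume (S ∩ Set.Ioo (-Real.pi) Real.pi) / ENNReal.ofReal (2 * Real.pi) := by
  set c : ℝ≥0∞ := ∫⁻ r in Set.Ioi (0 : ℝ),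
    ENNReal.ofReal r * ENNReal.ofReal ((2 * Real.pi)⁻¹ * Real.exp (-r ^ 2 / 2))
  have key {A : Set (ℝ × ℝ)} {S : Set ℝ} (hA : MeasurableSet A) (hS : MeasurableSet S)
      (h : ∀ r φ : ℝ, 0 < r → φ ∈ Set.Ioo (-Real.pi) Real.pi →
        ((r * Real.cos φ, r * Real.sin φ) ∈ A ↔ φ ∈ S)) :
      ((gaussianReal 0 1).prod (gaussianReal 0 1)) A =
        c * volume (S ∩ Set.Ioo (-Real.pi) Real.pi) := by
    rw [gaussianReal_of_var_ne_zero 0 one_ne_zero,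
      prod_withDensity (measurable_gaussianPDF 0 1) (measurable_gaussianPDF 0 1),
      withDensity_apply _ hA, ← lintegral_indicator hA, ← Measure.volume_eq_prod,
      ← lintegral_comp_polarCoord_symm]
    have hcongr : ∀ p ∈ polarCoord.target, ENNReal.ofReal p.1 •
        A.indicator (fun z => gaussianPDF 0 1 z.1 * gaussianPDF 0 1 z.2) (polarCoord.symm p) =
        (ENNReal.ofReal p.1 *
          ENNReal.ofReal ((2 * Real.pi)⁻¹ * Real.exp (-p.1 ^ 2 / 2))) * S.indicator 1 p.2 := by
      rintro ⟨r, φ⟩ ⟨hr, hφ⟩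
      have hdens : gaussianPDF 0 1 (r * Real.cos φ) * gaussianPDF 0 1 (r * Real.sin φ) =
          ENNReal.ofReal ((2 * Real.pi)⁻¹ * Real.exp (-r ^ 2 / 2)) := by
        rw [gaussianPDF, gaussianPDF, ← ENNReal.ofReal_mul (gaussianPDFReal_nonneg _ _ _)]
        congr 1
        simp only [gaussianPDFReal, NNReal.coe_one, mul_one, sub_zero]
        rw [mul_mul_mul_comm, ← mul_inv, Real.mul_self_sqrt (by positivity), ← Real.exp_add]
        congr 2
        linear_combination (-r ^ 2 / 2) * Real.sin_sq_add_cos_sq φ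
      have hmem := h r φ hr hφ
      by_cases hφS : φ ∈ S
      · simp [hφS, hmem.2 hφS, hdens]
      · have := mt hmem.1 hφS
        simp [hφS, this]
    rw [setLIntegral_congr_fun polarCoord.open_target.measurableSet hcongr, polarCoord_target,
      Measure.volume_eq_prod, ← Measure.prod_restrict,
      lintegral_prod_mul (f := fun r => ENNReal.ofReal r *
        ENNReal.ofReal ((2 * Real.pi)⁻¹ * Real.exp (-r ^ 2 / 2))) (by fun_prop)
        (measurable_one.indicator hS).aemeasurable,
      lintegral_indicator_one hS, Measure.restrict_apply hS]
  have htotal : c * ENNReal.ofReal (2 * Real.pi) = 1 := by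
    have := key (A := Set.univ) (S := Set.univ) .univ .univ (by simp)
    rw [measure_univ, Set.univ_inter, Real.volume_Ioo] at this
    rw [this]
    ring_nf
  rw [key hA hS h, ENNReal.eq_inv_of_mul_eq_one_left htotal, mul_comm, div_eq_mul_inv]

/-- Two standard Gaussian variables with correlation angle `θ` have the same sign with
probability `1 - θ / π`. -/
theorem gaussianReal_prod_sign_eq {θ : ℝ} (h0 : 0 < θ) (hπ : θ < Real.pi) :
    ((gaussianReal 0 1).prod (gaussianReal 0 1))
      {p | Real.sign p.1 = Real.sign (Real.cos θ * p.1 + Real.sin θ * p.2)} =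
      ENNReal.ofReal (1 - θ / Real.pi) := by
  have := nullSingletonClass_gaussianReal (μ := 0) (v := 1) one_ne_zero
  set γ := (gaussianReal 0 1).prod (gaussianReal 0 1) with hγ
  set f : ℝ × ℝ → ℝ := fun p => Real.cos θ * p.1 + Real.sin θ * p.2 with hf
  have hfm : Measurable f := by fun_prop
  set P : Set (ℝ × ℝ) := {p | 0 < p.1 ∧ 0 < f p} with hP
  have hPm : MeasurableSet P :=
    (measurableSet_lt measurable_const measurable_fst).inter
      (measurableSet_lt measurable_const hfm)
  have hγP : γ P = ENNReal.ofReal (Real.pi - θ) / ENNReal.ofReal (2 * Real.pi) := by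
    rw [gaussianReal_prod_cone (S := Set.Ioo (θ - Real.pi / 2) (Real.pi / 2)) hPm
      measurableSet_Ioo, Set.inter_eq_left.2, Real.volume_Ioo]
    · ring_nf
    · exact Set.Ioo_subset_Ioo (by linarith) (by linarith)
    · rintro r φ hr ⟨hφ₁, hφ₂⟩
      have hrot : f (r * Real.cos φ, r * Real.sin φ) = r * Real.cos (φ - θ) := by
        simp only [hf, Real.cos_sub]
        ring
      simp only [hP, Set.mem_ofPred_eq, hrot, mul_pos_iff_of_pos_left hr, Set.mem_Ioo]
      constructor
      · rintro ⟨hc₁, hc₂⟩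
        have h₁ : φ < Real.pi / 2 := by
          by_contra! hle
          exact hc₁.not_ge (Real.cos_nonpos_of_pi_div_two_le_of_le hle (by linarith))
        have h₂ : -(Real.pi / 2) < φ := by
          by_contra! hle
          rw [← Real.cos_neg] at hc₁
          exact hc₁.not_ge
            (Real.cos_nonpos_of_pi_div_two_le_of_le (by linarith) (by linarith))
        refine ⟨?_, h₁⟩
        by_contra! hle
        rw [← Real.cos_neg] at hc₂
        exact hc₂.not_ge
          (Real.cos_nonpos_of_pi_div_two_le_of_le (by linarith) (by linarith))
      · rintro ⟨h₁, h₂⟩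
        exact ⟨Real.cos_pos_of_mem_Ioo ⟨by linarith, h₂⟩,
          Real.cos_pos_of_mem_Ioo ⟨by linarith, by linarith⟩⟩
  have hneg : γ.map (fun p => -p) = γ := by
    have hg : (gaussianReal 0 1).map (fun x : ℝ => -x) = gaussianReal 0 1 := by
      rw [gaussianReal_map_neg, neg_zero]
    calc γ.map (fun p => -p)
        = ((gaussianReal 0 1).map fun x => -x).prod ((gaussianReal 0 1).map fun x => -x) :=
          (Measure.map_prod_map _ _ measurable_neg measurable_neg).symm
      _ = γ := by rw [hg]
  have hγN : γ ((fun p => -p) ⁻¹' P) = γ P := by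
    rw [← Measure.map_apply measurable_neg hPm, hneg]
  have hnull : ∀ᵐ p ∂γ, p.1 ≠ 0 := by
    have : γ (({0} : Set ℝ) ×ˢ Set.univ) = 0 := by simp [hγ, Measure.prod_prod]
    rw [ae_iff]
    refine measure_mono_null (fun p hp => ?_) this
    simpa using hp
  have hunion : {p : ℝ × ℝ | Real.sign p.1 = Real.sign (f p)} =ᵐ[γ]
      (P ∪ (fun p => -p) ⁻¹' P : Set (ℝ × ℝ)) := by
    filter_upwards [hnull] with p hp
    have hfneg : f (-p) = -f p := by simp [hf]; ring
    refine propext ?_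
    change Real.sign p.1 = Real.sign (f p) ↔ (0 < p.1 ∧ 0 < f p) ∨ (0 < -p.1 ∧ 0 < f (-p))
    rw [hfneg]
    rcases lt_trichotomy p.1 0 with h₁ | h₁ | h₁ <;>
    rcases lt_trichotomy (f p) 0 with h₂ | h₂ | h₂ <;>
    simp_all [Real.sign_of_neg, Real.sign_of_pos, not_lt.2 h₁.le] <;> norm_num <;> grind
  have hdisj : Disjoint P ((fun p => -p) ⁻¹' P) := by
    rw [Set.disjoint_left]
    rintro p ⟨h₁, -⟩ ⟨h₂, -⟩
    simp only [Prod.fst_neg] at h₂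
    linarith
  have hπ0 := Real.pi_pos
  rw [measure_congr hunion, measure_union hdisj (measurable_neg hPm), hγN, hγP,
    ← ENNReal.ofReal_div_of_pos (by positivity), ← ENNReal.ofReal_add
      (div_nonneg (by linarith) (by positivity)) (div_nonneg (by linarith) (by positivity))]
  congr 1
  field_simp
  ring

theorem Real.sign_mul_of_pos {a : ℝ} (ha : 0 < a) (b : ℝ) :
    Real.sign (a * b) = Real.sign b := by
  rcases lt_trichotomy b 0 with h | rfl | h
  · rw [Real.sign_of_neg h, Real.sign_of_neg (mul_neg_of_pos_of_neg ha h)]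
  · rw [mul_zero]
  · rw [Real.sign_of_pos h, Real.sign_of_pos (mul_pos ha h)]

theorem Real.measurable_sign : Measurable Real.sign :=
  Measurable.ite measurableSet_Iio measurable_const
    (Measurable.ite measurableSet_Ioi measurable_const measurable_const)

/-- The signs of the projections of a standard Gaussian vector on two non-collinear vectors agree
with probability `1 - θ / π`, where `θ` is the angle between them. -/
theorem stdGaussian_sign_inner_eq {E : Type*} [NormedAddCommGroup E] [InnerProductSpace ℝ E]
    [FiniteDimensional ℝ E] [MeasurableSpace E] [BorelSpace E] {x y : E}
    (hx : x ≠ 0) (hy : y ≠ 0) (hxy : ¬∃ c : ℝ, y = c • x) :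
    (stdGaussian E) {w | Real.sign (inner ℝ x w) = Real.sign (inner ℝ y w)} =
      ENNReal.ofReal (1 - InnerProductGeometry.angle x y / Real.pi) := by
  set θ := InnerProductGeometry.angle x y with hθ
  have h0 : 0 < θ := (InnerProductGeometry.angle_nonneg x y).lt_of_ne' fun h => by
    obtain ⟨-, r, -, hr⟩ := InnerProductGeometry.angle_eq_zero_iff.1 h
    exact hxy ⟨r, hr⟩
  have hπ : θ < Real.pi := (InnerProductGeometry.angle_le_pi x y).lt_of_ne fun h => by
    obtain ⟨-, r, -, hr⟩ := InnerProductGeometry.angle_eq_pi_iff.1 h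
    exact hxy ⟨r, hr⟩
  have hsin : 0 < Real.sin θ := Real.sin_pos_of_pos_of_lt_pi h0 hπ
  have hnx : 0 < ‖x‖ := norm_pos_iff.2 hx
  have hny : 0 < ‖y‖ := norm_pos_iff.2 hy
  obtain ⟨u, hu⟩ : ∃ u : E, u = ‖x‖⁻¹ • x := ⟨_, rfl⟩
  obtain ⟨z, hz⟩ : ∃ z : E, z = ‖y‖⁻¹ • y := ⟨_, rfl⟩
  obtain ⟨v, hv⟩ : ∃ v : E, v = (Real.sin θ)⁻¹ • (z - Real.cos θ • u) := ⟨_, rfl⟩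
  have huu : inner ℝ u u = 1 := by
    rw [real_inner_self_eq_norm_sq, hu, norm_smul, norm_inv, norm_norm,
      inv_mul_cancel₀ hnx.ne', one_pow]
  have hzz : inner ℝ z z = 1 := by
    rw [real_inner_self_eq_norm_sq, hz, norm_smul, norm_inv, norm_norm,
      inv_mul_cancel₀ hny.ne', one_pow]
  have huz : inner ℝ u z = Real.cos θ := by
    rw [hθ, InnerProductGeometry.cos_angle, hu, hz, real_inner_smul_left, real_inner_smul_right]
    field_simp
  have huv : inner ℝ u v = 0 := by
    rw [hv, real_inner_smul_right, inner_sub_right, real_inner_smul_right, huu, huz]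
    ring
  have hvv : inner ℝ v v = 1 := by
    rw [hv, real_inner_smul_right, real_inner_smul_left, inner_sub_right, inner_sub_left,
      inner_sub_left, real_inner_smul_right, real_inner_smul_left, real_inner_smul_right,
      real_inner_smul_left, hzz, huu, real_inner_comm u z, huz]
    field_simp
    linear_combination -Real.sin_sq_add_cos_sq θ
  have horth : Orthonormal ℝ ![u, v] := by
    have hnu : ‖u‖ = 1 := by rw [norm_eq_sqrt_real_inner, huu, Real.sqrt_one]
    have hnv : ‖v‖ = 1 := by rw [norm_eq_sqrt_real_inner, hvv, Real.sqrt_one]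
    rw [orthonormal_iff_ite]
    intro i j
    fin_cases i <;> fin_cases j <;> simp [hnu, hnv, huv, real_inner_comm u v]
  have hlaw : (stdGaussian E).map (fun w => (inner ℝ u w, inner ℝ v w)) =
      (gaussianReal 0 1).prod (gaussianReal 0 1) := by
    rw [← (measurePreserving_finTwoArrow (gaussianReal 0 1)).map_eq,
      ← map_inner_stdGaussian horth, Measure.map_map (MeasurableEquiv.measurable _) (by fun_prop)]
    rfl
  have hxu : x = ‖x‖ • u := by rw [hu, smul_inv_smul₀ hnx.ne']
  have hyuv : y = ‖y‖ • (Real.cos θ • u + Real.sin θ • v) := by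
    rw [hv, smul_inv_smul₀ hsin.ne', add_sub_cancel, hz, smul_inv_smul₀ hny.ne']
  rw [← gaussianReal_prod_sign_eq h0 hπ, ← hlaw, Measure.map_apply (by fun_prop)]
  · congr 1
    ext w
    simp only [Set.mem_preimage, Set.mem_ofPred_eq]
    have h₁ : Real.sign (inner ℝ x w) = Real.sign (inner ℝ u w) := by
      conv_lhs => rw [hxu]
      rw [real_inner_smul_left, Real.sign_mul_of_pos hnx]
    have h₂ : Real.sign (inner ℝ y w) =
        Real.sign (Real.cos θ * inner ℝ u w + Real.sin θ * inner ℝ v w) := by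
      conv_lhs => rw [hyuv]
      rw [real_inner_smul_left, Real.sign_mul_of_pos hny, inner_add_left, real_inner_smul_left,
        real_inner_smul_left]
    rw [h₁, h₂]
  · exact measurableSet_eq_fun (Real.measurable_sign.comp (by fun_prop))
      (Real.measurable_sign.comp (by fun_prop))

/-- **SimHash (signed random projection) collision probability.**
Let `x, y ∈ ℝ^D` be nonzero vectors, neither a scalar multiple of the other, with angle
`θ = arccos (⟨x, y⟩ / (‖x‖ ‖y‖))`. If `w` is a standard Gaussian random vector in `ℝ^D`
(its direction is uniform on the sphere), then the probability that the signed random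
projections agree is `P[sign ⟨w, x⟩ = sign ⟨w, y⟩] = 1 − θ / π`. -/
theorem simhash_collision_probability {D : ℕ} (x y : Fin D → ℝ)
    (hx : x ≠ 0) (hy : y ≠ 0)
    (hxy : ¬∃ c : ℝ, y = c • x) (hyx : ¬∃ c : ℝ, x = c • y) :
    (Measure.pi fun _ : Fin D => gaussianReal 0 1)
        {w | Real.sign (∑ i, w i * x i) = Real.sign (∑ i, w i * y i)} =
      ENNReal.ofReal
        (1 - Real.arccos ((∑ i, x i * y i) /
          (Real.sqrt (∑ i, x i ^ 2) * Real.sqrt (∑ i, y i ^ 2))) / Real.pi) := by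
  have hmeas : Measurable (WithLp.toLp 2 : (Fin D → ℝ) → EuclideanSpace ℝ (Fin D)) := by fun_prop
  have hsum (a b : Fin D → ℝ) : inner ℝ (WithLp.toLp 2 a) (WithLp.toLp 2 b) = ∑ i, a i * b i := by
    simp [PiLp.inner_apply, mul_comm]
  have hnorm (a : Fin D → ℝ) : ‖WithLp.toLp 2 a‖ = Real.sqrt (∑ i, a i ^ 2) := by
    simp [EuclideanSpace.norm_eq]
  have h := stdGaussian_sign_inner_eq (x := WithLp.toLp 2 x) (y := WithLp.toLp 2 y)
    (by simpa using hx) (by simpa using hy) fun ⟨c, hc⟩ => hxy ⟨c, congrArg WithLp.ofLp hc⟩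
  rw [InnerProductGeometry.angle, hsum, hnorm, hnorm] at h
  rw [← h, ← map_pi_eq_stdGaussian, Measure.map_apply hmeas]
  · simp only [Set.preimage_ofPred_eq, hsum, mul_comm]
  · exact measurableSet_eq_fun (Real.measurable_sign.comp (by fun_prop))
      (Real.measurable_sign.comp (by fun_prop))
end
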